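/- arXiv:0805.0045 — 7 statements merged into one kernel-verified Lean document; each statement's English description precedes it below -/
import Mathlib

section
/- Let V be a finite-dimensional k̄-vector space and let Φ : V → V be a σ-linear map (not assumed bijective). Then the k-linear map V → V given by v ↦ v − Φ(v) is surjective. -/
open Polynomial in
/-- If `q = 0` in `K`, then for coefficients `c` in the algebraically closed field `K` and
`m : ℕ`, the recursion `b (i + 1) = b i ^ q + c i * b m ^ q` with `b 0 = 1` has a solution. -/
theorem exists_pow_recursion_eq {K : Type*} [Field K] [IsAlgClosed K] {q : ℕ} (hq : (q : K) = 0)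
    (c : ℕ → K) (m : ℕ) :
    ∃ b : ℕ → K, b 0 = 1 ∧ ∀ i, b (i + 1) = b i ^ q + c i * b m ^ q := by
  let B : ℕ → K[X] := fun i => Nat.rec 1 (fun i P => P ^ q + C (c i) * X ^ q) i
  have hB : ∀ i, derivative (B i) = 0
    | 0 => derivative_one
    | i + 1 => by
      change derivative (B i ^ q + C (c i) * X ^ q) = 0
      simp [derivative_pow, hq]
  have hdeg : (B m - X).degree ≠ 0 := fun h => by
    have h1 : derivative (B m - X) = 0 := by
      rw [eq_C_of_degree_eq_zero h, derivative_C]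
    simp [hB] at h1
  obtain ⟨t, ht⟩ := IsAlgClosed.exists_root _ hdeg
  have ht : (B m).eval t = t := by simpa [sub_eq_zero] using ht
  refine ⟨fun i => (B i).eval t, eval_one, fun i => ?_⟩
  simp only [ht]
  change (B i ^ q + C (c i) * X ^ q).eval t = _
  simp

/-- In a finite-dimensional space, some term of any sequence is a combination of the previous
terms. -/
theorem exists_eq_sum_range_smul {K V : Type*} [Field K] [AddCommGroup V] [Module K V]
    [FiniteDimensional K V] (f : ℕ → V) :
    ∃ (m : ℕ) (c : ℕ → K), f m = ∑ i ∈ Finset.range m, c i • f i := by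
  let S : ℕ →o Submodule K V :=
    ⟨fun n => Submodule.span K (f '' Finset.range n), fun _ _ h =>
      Submodule.span_mono (Set.image_mono (Finset.coe_subset.mpr (Finset.range_mono h)))⟩
  obtain ⟨m, hm⟩ := monotone_stabilizes_iff_noetherian.mpr inferInstance S
  have hmem : f m ∈ S m := by
    rw [hm (m + 1) m.le_succ]
    exact Submodule.subset_span ⟨m, by simp, rfl⟩
  obtain ⟨c, hc⟩ := (Submodule.mem_span_image_finset_iff_exists_fun' K).mp hmem
  exact ⟨m, c, hc.symm⟩

/-- Let `k = 𝔽_q` (with `q = p ^ n`), `K = k̄` an algebraic closure of `k`,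
and `σ : K ≃+* K` the Frobenius automorphism `x ↦ x ^ q`.  If `V` is a finite-dimensional
`K`-vector space and `Φ : V → V` is a `σ`-linear map (additive, `Φ (a • v) = σ a • Φ v`,
not assumed bijective), then the `k`-linear map `v ↦ v - Φ v` is surjective. -/
theorem sigma_linear_sub_surjective
    (p n : ℕ) [Fact p.Prime] (hn : n ≠ 0)
    (K : Type*) [Field K] [Algebra (GaloisField p n) K] [IsAlgClosure (GaloisField p n) K]
    (σ : K ≃+* K) (hσ : ∀ x : K, σ x = x ^ p ^ n)
    (V : Type*) [AddCommGroup V] [Module K V] [FiniteDimensional K V]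
    (Φ : V → V)
    (hadd : ∀ u v : V, Φ (u + v) = Φ u + Φ v)
    (hsmul : ∀ (a : K) (v : V), Φ (a • v) = σ a • Φ v) :
    ∀ w : V, ∃ v : V, v - Φ v = w := by
  intro w
  have : IsAlgClosed K := IsAlgClosure.isAlgClosed (GaloisField p n)
  have : CharP K p := charP_of_injective_algebraMap (algebraMap (GaloisField p n) K).injective p
  have hq : ((p ^ n : ℕ) : K) = 0 := by simp [hn]
  obtain ⟨m, c, hm⟩ := exists_eq_sum_range_smul (K := K) fun i => Φ^[i] w
  obtain ⟨b, hb0, hb⟩ := exists_pow_recursion_eq hq c m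
  have hzero : Φ 0 = 0 := by simpa using hadd 0 0
  have key (j : ℕ) :
      (∑ i ∈ Finset.range j, b (i + 1) • Φ^[i] w) - Φ (∑ i ∈ Finset.range j, b (i + 1) • Φ^[i] w)
        = w - b j ^ p ^ n • Φ^[j] w + b m ^ p ^ n • ∑ i ∈ Finset.range j, c i • Φ^[i] w := by
    induction j with
    | zero => simp [hzero, hb0]
    | succ j ih =>
      rw [Finset.sum_range_succ, Finset.sum_range_succ, hadd, hsmul, hσ, add_sub_add_comm, ih,
        ← Function.iterate_succ_apply' Φ j w]
      linear_combination (norm := module) hb j • Φ^[j] w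
  exact ⟨_, by rw [key m, ← hm, sub_add_cancel]⟩
end

section
/- Let V be a finite-dimensional k̄-vector space and let Φ : V → V be a σ⁻¹-linear map (not assumed bijective). Then the k-linear map V → V given by v ↦ v − Φ(v) is surjective. -/
open Polynomial in
/-- A nontrivial polynomial `∑ cᵢ X ^ (q ^ i)` with `2 ≤ q` takes the value `1` over an
algebraically closed field. -/
theorem IsAlgClosed.exists_sum_mul_pow_pow_eq_one {K : Type*} [Field K] [IsAlgClosed K]
    {q : ℕ} (hq : 2 ≤ q) (s : Finset ℕ) (c : ℕ → K) {j : ℕ} (hj : j ∈ s) (hcj : c j ≠ 0) :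
    ∃ z : K, ∑ i ∈ s, c i * z ^ q ^ i = 1 := by
  have hpos : 0 < q ^ j := by positivity
  set P : K[X] := ∑ i ∈ s, C (c i) * X ^ q ^ i - 1 with hP
  have hcoeff : P.coeff (q ^ j) = c j := by
    have h (i : ℕ) : q ^ j = q ^ i ↔ j = i := (Nat.pow_right_injective hq).eq_iff
    simp [hP, coeff_X_pow, coeff_one, h, hj]
    omega
  have hdeg : P.degree ≠ 0 := by
    intro h
    apply hcj
    rw [← hcoeff]
    apply coeff_eq_zero_of_degree_lt
    rw [h]
    exact_mod_cast hpos
  obtain ⟨z, hz⟩ := IsAlgClosed.exists_root P hdeg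
  refine ⟨z, ?_⟩
  simpa [hP, IsRoot, eval_finsetSum, sub_eq_zero] using hz

/-- If `Φ` is additive and `Φ (a ^ q • v) = a • Φ v`, then `a • Φ^[i] w` and `a ^ (q ^ i) • w`
agree modulo the image of `1 - Φ`. -/
theorem smul_iterate_sub_pow_smul_mem_range {K V : Type*} [Semiring K] [AddCommGroup V]
    [Module K V] {q : ℕ} (Φ : V →+ V) (hΦ : ∀ (a : K) (v : V), Φ (a ^ q • v) = a • Φ v)
    (w : V) (i : ℕ) (a : K) :
    a • Φ^[i] w - a ^ q ^ i • w ∈ (AddMonoidHom.id V - Φ).range := by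
  induction i generalizing a with
  | zero => simp
  | succ i ih =>
    have h₁ : a ^ q • Φ^[i] w - a • Φ^[i + 1] w ∈ (AddMonoidHom.id V - Φ).range :=
      ⟨a ^ q • Φ^[i] w, by simp [hΦ, Function.iterate_succ_apply']⟩
    have h₂ := sub_mem (ih (a ^ q)) h₁
    rw [← pow_mul, ← pow_succ'] at h₂
    convert h₂ using 1
    abel

/-- Let `k = 𝔽_q` (with `q = p ^ n`), `K = k̄` an algebraic closure of `k`,
and `σ : K ≃+* K` the Frobenius automorphism `x ↦ x ^ q`.  If `V` is a finite-dimensional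
`K`-vector space and `Φ : V → V` is a `σ⁻¹`-linear map (additive,
`Φ (a • v) = σ⁻¹ a • Φ v`, not assumed bijective), then the `k`-linear map
`v ↦ v - Φ v` is surjective. -/
theorem sigma_inv_linear_sub_surjective
    (p n : ℕ) [Fact p.Prime] (hn : n ≠ 0)
    (K : Type*) [Field K] [Algebra (GaloisField p n) K] [IsAlgClosure (GaloisField p n) K]
    (σ : K ≃+* K) (hσ : ∀ x : K, σ x = x ^ p ^ n)
    (V : Type*) [AddCommGroup V] [Module K V] [FiniteDimensional K V]
    (Φ : V → V)
    (hadd : ∀ u v : V, Φ (u + v) = Φ u + Φ v)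
    (hsmul : ∀ (a : K) (v : V), Φ (a • v) = σ.symm a • Φ v) :
    ∀ w : V, ∃ v : V, v - Φ v = w := by
  have : IsAlgClosed K := IsAlgClosure.isAlgClosed (GaloisField p n)
  have hq : 2 ≤ p ^ n := (Fact.out : p.Prime).two_le.trans (Nat.le_self_pow hn p)
  intro w
  have hΦ (a : K) (v : V) : Φ (a ^ p ^ n • v) = a • Φ v := by
    rw [hsmul, ← hσ, σ.symm_apply_apply]
  have hdep : ¬ LinearIndependent K fun i : ℕ => Φ^[i] w := fun h =>
    not_finite_iff_infinite.2 inferInstance h.finite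
  obtain ⟨s, g, hg, j, hj, hgj⟩ := not_linearIndependent_iff.1 hdep
  obtain ⟨z, hz⟩ := IsAlgClosed.exists_sum_mul_pow_pow_eq_one hq s
    (fun i => g i ^ (p ^ n) ^ i) hj (pow_ne_zero _ hgj)
  have hmem : ∑ i ∈ s, ((z * g i) • Φ^[i] w - (z * g i) ^ (p ^ n) ^ i • w) ∈
      (AddMonoidHom.id V - AddMonoidHom.mk' Φ hadd).range :=
    sum_mem fun i _ =>
      smul_iterate_sub_pow_smul_mem_range (AddMonoidHom.mk' Φ hadd) hΦ w i (z * g i)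
  have hsum : ∑ i ∈ s, ((z * g i) • Φ^[i] w - (z * g i) ^ (p ^ n) ^ i • w) = -w := by
    simp_rw [Finset.sum_sub_distrib, mul_smul, ← Finset.smul_sum, hg, ← Finset.sum_smul, mul_pow,
      mul_comm (z ^ _), hz]
    simp
  rw [hsum, neg_mem_iff] at hmem
  exact hmem
end

section
/- Let V₀ be a finite-dimensional k-vector space, let V = k̄ ⊗_k V₀, and let σ_V : V → V be the σ-linear map determined by σ_V(a ⊗ v) = σ(a) ⊗ v. Then for every k̄-linear map M : V → V and every w ∈ V there exists v ∈ V such that σ_V(v) − M(v) = w. -/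
open TensorProduct

open Polynomial in
/-- Over an algebraically closed field, an inhomogeneous equation in the monomials
`x ^ q ^ i`, monic of top exponent `q ^ d`, has a solution. -/
theorem IsAlgClosed.exists_pow_pow_sub_sum_eq {K : Type*} [Field K] [IsAlgClosed K] {q : ℕ}
    (hq : 1 < q) (d : ℕ) (a : ℕ → K) (b : K) :
    ∃ c : K, c ^ q ^ d - ∑ i ∈ Finset.range d, a i * c ^ q ^ i = b := by
  have hpos : 0 < q ^ d := pow_pos (by omega) d
  have hlow : (∑ i ∈ Finset.range d, C (a i) * X ^ q ^ i + C b : K[X]).degree < (q ^ d : ℕ) := by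
    refine (degree_add_le _ _).trans_lt (max_lt ?_ ?_)
    · refine (degree_sum_le _ _).trans_lt ((Finset.sup_lt_iff (WithBot.bot_lt_coe _)).2 ?_)
      intro i hi
      refine (degree_C_mul_X_pow_le _ _).trans_lt ?_
      exact_mod_cast Nat.pow_lt_pow_right hq (Finset.mem_range.1 hi)
    · exact degree_C_le.trans_lt (by exact_mod_cast hpos)
  have hdeg := degree_sub_eq_left_of_degree_lt (hlow.trans_eq (degree_X_pow _).symm)
  rw [degree_X_pow] at hdeg
  obtain ⟨c, hc⟩ := IsAlgClosed.exists_root _ (hdeg.trans_ne (by exact_mod_cast hpos.ne'))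
  refine ⟨c, ?_⟩
  simp only [IsRoot.def, eval_sub, eval_add, eval_pow, eval_X, eval_finsetSum, eval_mul,
    eval_C] at hc
  linear_combination hc

/-- In a Noetherian module, some iterate of a point is a linear combination of the earlier ones. -/
theorem exists_iterate_eq_sum_smul {R V : Type*} [Ring R] [AddCommGroup V] [Module R V]
    [IsNoetherian R V] (T : V → V) (w : V) :
    ∃ (d : ℕ) (a : ℕ → R), T^[d] w = ∑ i ∈ Finset.range d, a i • T^[i] w := by
  let f : ℕ →o Submodule R V :=
    ⟨fun m => Submodule.span R ((fun i => T^[i] w) '' (Finset.range m : Set ℕ)), fun m m' h =>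
      Submodule.span_mono (Set.image_mono (by simpa using h))⟩
  obtain ⟨d, hd⟩ := monotone_stabilizes_iff_noetherian.2 ‹IsNoetherian R V› f
  have hmem : T^[d] w ∈ f d := by
    rw [hd (d + 1) d.le_succ]
    exact Submodule.subset_span ⟨d, by simp, rfl⟩
  obtain ⟨a, ha⟩ := (Submodule.mem_span_image_finset_iff_exists_fun' R).1 hmem
  exact ⟨d, a, ha.symm⟩

/-- If `T` is additive and inverse-Frobenius-linear on a finite-dimensional space over an
algebraically closed field, then `1 - T` is surjective. -/
theorem surjective_sub_of_map_pow_smul {K V : Type*} [Field K] [IsAlgClosed K] [AddCommGroup V]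
    [Module K V] [FiniteDimensional K V] {q : ℕ} (hq : 1 < q) (T : V →+ V)
    (hT : ∀ (a : K) (v : V), T (a ^ q • v) = a • T v) (w : V) : ∃ v, v - T v = w := by
  let U : AddSubgroup V := (AddMonoidHom.id V - T).range
  have hU (v : V) : v - T v ∈ U := ⟨v, rfl⟩
  have key (i : ℕ) : ∀ x : K, x ^ q ^ i • w - x • T^[i] w ∈ U := by
    induction i with
    | zero => simp [U.zero_mem]
    | succ i ih =>
      intro x
      have h := U.add_mem (ih (x ^ q)) (hU (x ^ q • T^[i] w))
      rwa [hT, ← pow_mul, ← pow_succ', sub_add_sub_cancel, ← Function.iterate_succ_apply' T] at h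
  obtain ⟨d, a, ha⟩ := exists_iterate_eq_sum_smul (R := K) T w
  obtain ⟨c, hc⟩ := IsAlgClosed.exists_pow_pow_sub_sum_eq hq d (fun i => a i ^ q ^ i) (1 : K)
  have h := U.sub_mem (key d c)
    (U.sum_mem fun i (_ : i ∈ Finset.range d) => key i (a i * c))
  have hw : w ∈ U := by
    convert h using 1
    have hsum : ∑ i ∈ Finset.range d, (a i * c) • T^[i] w = c • T^[d] w := by
      simp only [ha, Finset.smul_sum, smul_smul, mul_comm c]
    rw [Finset.sum_sub_distrib, hsum, sub_sub_sub_cancel_right, ← Finset.sum_smul, ← sub_smul]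
    simp only [mul_pow, hc, one_smul]
  exact hw

/-- Let `k = 𝔽_q` (with `q = p ^ n`), `K = k̄` an algebraic closure of `k`,
and `σ : K ≃+* K` the Frobenius `x ↦ x ^ q`.  Let `V₀` be a finite-dimensional `k`-vector
space, `V = K ⊗[k] V₀`, and let `σV : V → V` be the (additive) `σ`-linear map determined by
`σV (a ⊗ v) = σ a ⊗ v`.  Then for every `K`-linear map `M : V → V` and every `w ∈ V` there
exists `v ∈ V` with `σV v - M v = w`. -/
theorem frobenius_sub_linear_surjective
    (p n : ℕ) [Fact p.Prime] (hn : n ≠ 0)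
    (K : Type*) [Field K] [Algebra (GaloisField p n) K] [IsAlgClosure (GaloisField p n) K]
    (σ : K ≃+* K) (hσ : ∀ x : K, σ x = x ^ p ^ n)
    (V₀ : Type*) [AddCommGroup V₀] [Module (GaloisField p n) V₀]
    [FiniteDimensional (GaloisField p n) V₀]
    (σV : K ⊗[GaloisField p n] V₀ → K ⊗[GaloisField p n] V₀)
    (hadd : ∀ u v : K ⊗[GaloisField p n] V₀, σV (u + v) = σV u + σV v)
    (hpure : ∀ (a : K) (v : V₀),
      σV (a ⊗ₜ[GaloisField p n] v) = σ a ⊗ₜ[GaloisField p n] v)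
    (M : K ⊗[GaloisField p n] V₀ →ₗ[K] K ⊗[GaloisField p n] V₀) :
    ∀ w : K ⊗[GaloisField p n] V₀, ∃ v : K ⊗[GaloisField p n] V₀, σV v - M v = w := by
  intro w
  have : IsAlgClosed K := IsAlgClosure.isAlgClosed (GaloisField p n)
  let b₀ := Module.finBasis (GaloisField p n) V₀
  let b := b₀.baseChange K
  let F := AddMonoidHom.mk' σV hadd
  let G : K ⊗[GaloisField p n] V₀ →+ K ⊗[GaloisField p n] V₀ :=
    AddMonoidHom.mk' (fun v => ∑ i, σ.symm (b.repr v i) • b i) fun u v => by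
      simp [add_smul, Finset.sum_add_distrib]
  have hFG (v : K ⊗[GaloisField p n] V₀) : F (G v) = v := by
    conv_rhs => rw [← b.sum_repr v]
    simp only [G, AddMonoidHom.mk'_apply, map_sum]
    refine Finset.sum_congr rfl fun i _ => ?_
    simp [F, b, Module.Basis.baseChange_apply, TensorProduct.smul_tmul', hpure]
  have hG (a : K) (v : K ⊗[GaloisField p n] V₀) : G (a ^ p ^ n • v) = a • G v := by
    simp only [G, AddMonoidHom.mk'_apply, ← hσ, map_smul, Finsupp.smul_apply, smul_eq_mul,
      map_mul, RingEquiv.symm_apply_apply, mul_smul, Finset.smul_sum]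
  obtain ⟨v, hv⟩ := surjective_sub_of_map_pow_smul
    (Nat.one_lt_pow hn (Fact.out : p.Prime).one_lt) (G.comp M.toAddMonoidHom)
    (fun (a : K) v => by simp [hG]) (G w)
  refine ⟨v, ?_⟩
  have h := congrArg F hv
  rw [map_sub, hFG] at h
  simpa [hFG, F] using h
end

section
/- Let V be a finite-dimensional k̄-vector space and Φ : V → V a σ-linear map. If the pair (V, Φ) is simple, i.e. V ≠ 0 and the only k̄-subspaces W ⊆ V with Φ(W) ⊆ W are 0 and V, then dim_{k̄} V = 1. -/
open Polynomial in
/-- The polynomials giving the coordinates, in terms of the last one, of a fixed vector of a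
Frobenius-semilinear map in a cyclic basis. -/
noncomputable def frobCoord {K : Type*} [Field K] (q : ℕ) (a : ℕ → K) : ℕ → K[X]
  | 0 => C (a 0) * X ^ q
  | i + 1 => frobCoord q a i ^ q + C (a (i + 1)) * X ^ q

open Polynomial in
theorem X_sq_dvd_frobCoord {K : Type*} [Field K] {q : ℕ} (hq : 2 ≤ q) (a : ℕ → K) (i : ℕ) :
    (X ^ 2 : K[X]) ∣ frobCoord q a i := by
  induction i with
  | zero => exact (pow_dvd_pow X hq).mul_left _
  | succ i ih =>
    exact dvd_add (ih.trans (dvd_pow_self _ (by lia))) ((pow_dvd_pow X hq).mul_left _)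

open Polynomial in
theorem frobCoord_eq_zero_or_le_natDegree {K : Type*} [Field K] {q : ℕ} (hq : 2 ≤ q)
    (a : ℕ → K) (i : ℕ) :
    (frobCoord q a i = 0 ∧ ∀ j ≤ i, a j = 0) ∨ q ≤ (frobCoord q a i).natDegree := by
  induction i with
  | zero =>
    by_cases h : a 0 = 0
    · left; simp [frobCoord, h]
    · right; simp [frobCoord, natDegree_C_mul_X_pow q _ h]
  | succ i ih =>
    rcases ih with ⟨h0, hj⟩ | hd
    · by_cases h : a (i + 1) = 0
      · refine .inl ⟨by simp [frobCoord, h, h0, show q ≠ 0 by lia], fun j hji ↦ ?_⟩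
        rcases Nat.le_succ_iff.mp hji with h' | rfl
        exacts [hj j h', h]
      · right
        simp [frobCoord, h0, show q ≠ 0 by lia, natDegree_C_mul_X_pow q _ h]
    · right
      have hlt : q < (frobCoord q a i ^ q).natDegree := by
        rw [natDegree_pow]; nlinarith
      rw [frobCoord, natDegree_add_eq_left_of_natDegree_lt
        ((natDegree_C_mul_X_pow_le _ _).trans_lt hlt)]
      exact hlt.le

open Polynomial in
/-- A nonzero polynomial divisible by `X ^ 2` has a nonzero fixed point. -/
theorem exists_ne_zero_eval_eq_self {K : Type*} [Field K] [IsAlgClosed K] {P : K[X]}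
    (hP : P ≠ 0) (hdvd : X ^ 2 ∣ P) : ∃ t : K, t ≠ 0 ∧ P.eval t = t := by
  obtain ⟨S, rfl⟩ := hdvd
  have hS : S ≠ 0 := right_ne_zero_of_mul hP
  have hdeg : (X * S - C 1).degree ≠ 0 := by
    intro h
    have := natDegree_eq_of_degree_eq_some h
    rw [natDegree_sub_C, natDegree_X_mul hS] at this
    simp at this
  obtain ⟨t, ht⟩ := IsAlgClosed.exists_root _ hdeg
  have ht' : t * S.eval t = 1 := by simpa [sub_eq_zero] using ht
  refine ⟨t, left_ne_zero_of_mul_eq_one ht', ?_⟩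
  simp only [eval_mul, eval_pow, eval_X]
  rw [pow_two, mul_assoc, ht', mul_one]

/-- In a finite-dimensional space, a sequence starting with a nonzero vector has a nonempty
linearly independent initial segment whose span contains the next term. -/
theorem exists_linearIndependent_initial_segment {K V : Type*} [Field K] [AddCommGroup V]
    [Module K V] [FiniteDimensional K V] (u : ℕ → V) (hu : u 0 ≠ 0) :
    ∃ (e : ℕ) (a : ℕ → K), LinearIndependent K (fun i : Fin (e + 1) ↦ u i) ∧
      u (e + 1) = ∑ i ∈ Finset.range (e + 1), a i • u i := by
  classical
  have hex : ∃ m : ℕ, ¬ LinearIndependent K (fun i : Fin m ↦ u i) :=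
    ⟨Module.finrank K V + 1, fun h ↦ by simpa using h.fintype_card_le_finrank⟩
  obtain ⟨m, hm, hmin⟩ : ∃ m : ℕ, ¬ LinearIndependent K (fun i : Fin m ↦ u i) ∧
      ∀ l < m, LinearIndependent K (fun i : Fin l ↦ u i) :=
    ⟨Nat.find hex, Nat.find_spec hex, fun l hl ↦ not_not.mp (Nat.find_min hex hl)⟩
  match m, hm, hmin with
  | 0, hm, _ => exact absurd linearIndependent_empty_type hm
  | 1, hm, _ => exact absurd (LinearIndependent.of_subsingleton (0 : Fin 1) hu) hm
  | e + 2, hm, hmin =>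
    have hli := hmin (e + 1) (by lia)
    have hmem : u (e + 1) ∈ Submodule.span K (Set.range fun i : Fin (e + 1) ↦ u i) := by
      by_contra h
      exact hm (linearIndependent_finSucc'.mpr ⟨hli, h⟩)
    obtain ⟨c, hc⟩ := (Submodule.mem_span_range_iff_exists_fun K).mp hmem
    refine ⟨e, fun i ↦ if h : i < e + 1 then c ⟨i, h⟩ else 0, hli, ?_⟩
    rw [← hc, ← Fin.sum_univ_eq_sum_range
      (fun i ↦ (if h : i < e + 1 then c ⟨i, h⟩ else 0) • u i)]
    exact Finset.sum_congr rfl fun i _ ↦ by rw [dif_pos i.isLt]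

/-- A Frobenius-semilinear map on a nonzero finite-dimensional space over an algebraically
closed field stabilizes a line. -/
theorem exists_ne_zero_frobenius_semilinear_eq_smul {K V : Type*} [Field K] [IsAlgClosed K]
    [AddCommGroup V] [Module K V] [FiniteDimensional K V] [Nontrivial V] {q : ℕ} (hq : 2 ≤ q)
    (Φ : V →+ V) (hsmul : ∀ (a : K) (v : V), Φ (a • v) = a ^ q • Φ v) :
    ∃ (w : V) (c : K), w ≠ 0 ∧ Φ w = c • w := by
  obtain ⟨v, hv⟩ := exists_ne (0 : V)
  obtain ⟨e, a, hli, hrel⟩ := exists_linearIndependent_initial_segment (K := K)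
    (fun i ↦ Φ^[i] v) hv
  have hstep (i : ℕ) : Φ (Φ^[i] v) = Φ^[i + 1] v := (Function.iterate_succ_apply' Φ i v).symm
  rcases frobCoord_eq_zero_or_le_natDegree hq a e with ⟨-, ha⟩ | hdeg
  · refine ⟨Φ^[e] v, 0, by simpa using hli.ne_zero (Fin.last e), ?_⟩
    rw [hstep, zero_smul]
    refine hrel.trans (Finset.sum_eq_zero fun i hi ↦ ?_)
    rw [ha i (Nat.lt_succ_iff.mp (Finset.mem_range.mp hi)), zero_smul]
  · have hP : frobCoord q a e ≠ 0 := by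
      rintro h
      simp [h] at hdeg
      lia
    obtain ⟨t, ht0, ht⟩ := exists_ne_zero_eval_eq_self hP (X_sq_dvd_frobCoord hq a e)
    set x : ℕ → K := fun i ↦ (frobCoord q a i).eval t with hx
    have hx0 : x 0 = t ^ q * a 0 := by
      simp [hx, frobCoord, mul_comm (t ^ q)]
    have hxs (i : ℕ) : x (i + 1) = x i ^ q + t ^ q * a (i + 1) := by
      simp [hx, frobCoord, mul_comm (t ^ q)]
    refine ⟨∑ i ∈ Finset.range (e + 1), x i • Φ^[i] v, 1, fun h ↦ ht0 ?_, ?_⟩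
    · rw [← Fin.sum_univ_eq_sum_range (fun i ↦ x i • Φ^[i] v)] at h
      have := Fintype.linearIndependent_iff.mp hli (fun i ↦ x i) h (Fin.last e)
      rw [← ht]
      simpa using this
    · have hxe : x e = t := ht
      simp only [map_sum, hsmul, hstep, one_smul]
      rw [Finset.sum_range_succ, hrel, hxe, Finset.smul_sum, Finset.sum_range_succ',
        ← add_assoc, ← Finset.sum_add_distrib, Finset.sum_range_succ' (fun i ↦ x i • Φ^[i] v)]
      simp only [hxs, hx0, add_smul, mul_smul]

/-- Let `k = 𝔽_q` (with `q = p ^ n`), `K = k̄` an algebraic closure of `k`,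
and `σ : K ≃+* K` the Frobenius `x ↦ x ^ q`.  Let `V` be a finite-dimensional `K`-vector
space and `Φ : V → V` a `σ`-linear map.  If the pair `(V, Φ)` is simple, i.e. `V ≠ 0` and
the only `K`-subspaces `W ⊆ V` with `Φ(W) ⊆ W` are `0` and `V`, then `dim_K V = 1`. -/
theorem simple_sigma_space_one_dimensional
    (p n : ℕ) [Fact p.Prime] (hn : n ≠ 0)
    (K : Type*) [Field K] [Algebra (GaloisField p n) K] [IsAlgClosure (GaloisField p n) K]
    (σ : K ≃+* K) (hσ : ∀ x : K, σ x = x ^ p ^ n)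
    (V : Type*) [AddCommGroup V] [Module K V] [FiniteDimensional K V]
    (Φ : V → V)
    (hadd : ∀ u v : V, Φ (u + v) = Φ u + Φ v)
    (hsmul : ∀ (a : K) (v : V), Φ (a • v) = σ a • Φ v)
    (hnz : ∃ v : V, v ≠ 0)
    (hsimple : ∀ W : Submodule K V, (∀ x ∈ W, Φ x ∈ W) → W = ⊥ ∨ W = ⊤) :
    Module.finrank K V = 1 := by
  have : IsAlgClosed K := IsAlgClosure.isAlgClosed (GaloisField p n)
  obtain ⟨v, hv⟩ := hnz
  have : Nontrivial V := ⟨v, 0, hv⟩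
  have hq : 2 ≤ p ^ n := (Fact.out : p.Prime).two_le.trans (Nat.le_self_pow hn p)
  obtain ⟨w, c, hw, hwc⟩ := exists_ne_zero_frobenius_semilinear_eq_smul (K := K) hq
    (AddMonoidHom.mk' Φ hadd) (fun a v ↦ by simp [hsmul, hσ])
  have hwc : Φ w = c • w := hwc
  have hstable : ∀ y ∈ Submodule.span K {w}, Φ y ∈ Submodule.span K {w} := by
    intro y hy
    obtain ⟨b, rfl⟩ := Submodule.mem_span_singleton.mp hy
    rw [hsmul, hwc]
    exact Submodule.smul_mem _ _ (Submodule.smul_mem _ _ (Submodule.mem_span_singleton_self w))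
  rcases hsimple _ hstable with h | h
  · exact absurd (Submodule.span_singleton_eq_bot.mp h) hw
  · rw [← finrank_top, ← h, finrank_span_singleton hw]
end

section
/- Let V be a finite-dimensional k̄-vector space and Φ : V → V a σ⁻¹-linear map. If the pair (V, Φ) is simple, i.e. V ≠ 0 and the only k̄-subspaces W ⊆ V with Φ(W) ⊆ W are 0 and V, then dim_{k̄} V = 1. -/
open Polynomial in
/-- Writing `N i = ∏ j < i, σ⁻ʲ c`, every equation `N (d + 1) = ∑ i ≤ d, a i * N i` is solvable
in `c` over an algebraically closed field, where `σ` is the `q`-power Frobenius. -/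
theorem exists_prod_iterate_frobenius_symm_eq_sum {K : Type*} [Field K] [IsAlgClosed K]
    {q : ℕ} (hq : 0 < q) (σ : K ≃+* K) (hσ : ∀ x : K, σ x = x ^ q) (d : ℕ) (a : ℕ → K) :
    ∃ c : K, ∏ j ∈ Finset.range (d + 1), σ.symm^[j] c =
      ∑ i ∈ Finset.range (d + 1), a i * ∏ j ∈ Finset.range i, σ.symm^[j] c := by
  set e : ℕ → ℕ := fun i => ∑ j ∈ Finset.range i, q ^ (d - j) with he
  have he_lt : ∀ i ∈ Finset.range (d + 1), e i < e (d + 1) := fun i hi =>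
    Finset.sum_lt_sum_of_subset
      (Finset.range_subset_range.2 (Finset.mem_range.1 hi).le) hi (by simp)
      (by positivity) (fun _ _ _ => by positivity)
  have hdeg : (∑ i ∈ Finset.range (d + 1), C (a i) * X ^ e i : K[X]).degree
      < (X ^ e (d + 1) : K[X]).degree := by
    rw [degree_X_pow]
    refine (degree_sum_le _ _).trans_lt ((Finset.sup_lt_iff (WithBot.bot_lt_coe _)).2 ?_)
    intro i hi
    exact (degree_C_mul_X_pow_le _ _).trans_lt (by exact_mod_cast he_lt i hi)
  obtain ⟨s, hs⟩ := IsAlgClosed.exists_root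
    (X ^ e (d + 1) - ∑ i ∈ Finset.range (d + 1), C (a i) * X ^ e i : K[X]) (by
      rw [degree_sub_eq_left_of_degree_lt hdeg, degree_X_pow]
      have h0 := he_lt 0 (by simp)
      exact_mod_cast (Nat.zero_le _).trans_lt h0 |>.ne')
  have hiter : ∀ j m : ℕ, j ≤ m → σ.symm^[j] (s ^ q ^ m) = s ^ q ^ (m - j) := by
    intro j
    induction j with
    | zero => simp
    | succ j ih =>
      intro m hm
      rw [Function.iterate_succ_apply', ih m (by lia), RingEquiv.symm_apply_eq, hσ, ← pow_mul,
        ← pow_succ]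
      congr 2
      lia
  have hprod : ∀ i ≤ d + 1, ∏ j ∈ Finset.range i, σ.symm^[j] (s ^ q ^ d) = s ^ e i := by
    intro i hi
    rw [he, ← Finset.prod_pow_eq_pow_sum]
    refine Finset.prod_congr rfl fun j hj => hiter j d ?_
    have := Finset.mem_range.1 hj
    lia
  refine ⟨s ^ q ^ d, ?_⟩
  rw [hprod _ le_rfl, Finset.sum_congr rfl fun i hi => by
    rw [hprod i (Finset.mem_range.1 hi).le]]
  simpa [IsRoot, eval_finsetSum, sub_eq_zero] using hs

section Semilinear

variable {K V : Type*} [Field K] [AddCommGroup V] [Module K V]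

theorem iterate_semilinear_smul {τ : K → K} {Φ : V → V}
    (hsmul : ∀ (a : K) (v : V), Φ (a • v) = τ a • Φ v) (i : ℕ) (a : K) (v : V) :
    Φ^[i] (a • v) = τ^[i] a • Φ^[i] v := by
  induction i generalizing a v with
  | zero => rfl
  | succ i ih => simp only [Function.iterate_succ_apply, hsmul, ih]

/-- The span of the first `d` iterates of `v` under `Φ`. -/
def iterateSpan (K : Type*) {V : Type*} [Field K] [AddCommGroup V] [Module K V]
    (Φ : V → V) (v : V) (d : ℕ) : Submodule K V :=
  Submodule.span K ((fun i => Φ^[i] v) '' (Finset.range d : Set ℕ))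

theorem iterateSpan_mono (Φ : V → V) (v : V) : Monotone (iterateSpan K Φ v) :=
  fun _ _ h => Submodule.span_mono
    (Set.image_mono (Finset.coe_subset.2 (Finset.range_subset_range.2 h)))

theorem iterate_mem_iterateSpan (Φ : V → V) (v : V) {i d : ℕ} (h : i < d) :
    Φ^[i] v ∈ iterateSpan K Φ v d :=
  Submodule.subset_span ⟨i, by simpa using h, rfl⟩

/-- Recursion for the remainder of `Φ ^ i` under right division by `Φ - c`. -/
theorem iterate_succ_sub_prod_smul {τ : K → K} {Φ : V → V}
    (hadd : ∀ u v : V, Φ (u + v) = Φ u + Φ v)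
    (hsmul : ∀ (a : K) (v : V), Φ (a • v) = τ a • Φ v) (c : K) (v : V) (i : ℕ) :
    Φ^[i + 1] v - (∏ j ∈ Finset.range (i + 1), τ^[j] c) • v =
      Φ^[i] (Φ v - c • v) + τ^[i] c • (Φ^[i] v - (∏ j ∈ Finset.range i, τ^[j] c) • v) := by
  have hsub : Φ^[i] (Φ v - c • v) = Φ^[i] (Φ v) - Φ^[i] (c • v) :=
    iterate_map_sub (AddMonoidHom.mk' Φ hadd) i (Φ v) (c • v)
  rw [hsub, iterate_semilinear_smul hsmul, Finset.prod_range_succ, Function.iterate_succ_apply]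
  module

theorem iterate_sub_prod_smul_mem_iterateSpan {τ : K → K} {Φ : V → V}
    (hadd : ∀ u v : V, Φ (u + v) = Φ u + Φ v)
    (hsmul : ∀ (a : K) (v : V), Φ (a • v) = τ a • Φ v) (c : K) (v : V) (i : ℕ) :
    Φ^[i] v - (∏ j ∈ Finset.range i, τ^[j] c) • v ∈ iterateSpan K Φ (Φ v - c • v) i := by
  induction i with
  | zero => simp
  | succ i ih =>
    rw [iterate_succ_sub_prod_smul hadd hsmul]
    exact add_mem (iterate_mem_iterateSpan _ _ i.lt_succ_self)
      (Submodule.smul_mem _ _ (iterateSpan_mono _ _ i.le_succ ih))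

theorem exists_eigenvector_of_iterate_mem_iterateSpan [IsAlgClosed K]
    {q : ℕ} (hq : 0 < q) (σ : K ≃+* K) (hσ : ∀ x : K, σ x = x ^ q) {Φ : V → V}
    (hadd : ∀ u v : V, Φ (u + v) = Φ u + Φ v)
    (hsmul : ∀ (a : K) (v : V), Φ (a • v) = σ.symm a • Φ v)
    (d : ℕ) {v : V} (hv : v ≠ 0) (hd : Φ^[d] v ∈ iterateSpan K Φ v d) :
    ∃ w : V, w ≠ 0 ∧ ∃ c : K, Φ w = c • w := by
  induction d generalizing v with
  | zero => exact absurd (by simpa [iterateSpan] using hd) hv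
  | succ d ih =>
    obtain ⟨a, ha⟩ := Submodule.mem_span_image_finset_iff_exists_fun' K |>.1 hd
    obtain ⟨c, hc⟩ := exists_prod_iterate_frobenius_symm_eq_sum hq σ hσ d a
    set u := Φ v - c • v with hu
    by_cases hu0 : u = 0
    · exact ⟨v, hv, c, sub_eq_zero.1 hu0⟩
    refine ih hu0 ?_
    have hlead := iterate_succ_sub_prod_smul hadd hsmul c v d
    have hrel : Φ^[d + 1] v - (∏ j ∈ Finset.range (d + 1), σ.symm^[j] c) • v =
        ∑ i ∈ Finset.range (d + 1),
          a i • (Φ^[i] v - (∏ j ∈ Finset.range i, σ.symm^[j] c) • v) := by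
      rw [hc, ← ha, Finset.sum_smul, ← Finset.sum_sub_distrib]
      exact Finset.sum_congr rfl fun i _ => by module
    rw [hrel, ← hu, ← sub_eq_iff_eq_add] at hlead
    rw [← hlead]
    have hmem : ∀ i ≤ d, Φ^[i] v - (∏ j ∈ Finset.range i, σ.symm^[j] c) • v ∈
        iterateSpan K Φ u d := fun i hi =>
      iterateSpan_mono _ _ hi (iterate_sub_prod_smul_mem_iterateSpan hadd hsmul c v i)
    exact sub_mem
      (sum_mem fun i hi => Submodule.smul_mem _ _
        (hmem i (Nat.lt_succ_iff.1 (Finset.mem_range.1 hi))))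
      (Submodule.smul_mem _ _ (hmem d le_rfl))

theorem exists_iterate_mem_iterateSpan [FiniteDimensional K V] (Φ : V → V) (v : V) :
    ∃ d, Φ^[d] v ∈ iterateSpan K Φ v d := by
  obtain ⟨d, hd⟩ := monotone_stabilizes_iff_noetherian.2 (inferInstance : IsNoetherian K V)
    ⟨iterateSpan K Φ v, iterateSpan_mono Φ v⟩
  refine ⟨d, ?_⟩
  have h : iterateSpan K Φ v d = iterateSpan K Φ v (d + 1) := hd (d + 1) d.le_succ
  rw [h]
  exact iterate_mem_iterateSpan Φ v d.lt_succ_self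

end Semilinear

/-- Let `k = 𝔽_q` (with `q = p ^ n`), `K = k̄` an algebraic closure of `k`,
and `σ : K ≃+* K` the Frobenius `x ↦ x ^ q`.  Let `V` be a finite-dimensional `K`-vector
space and `Φ : V → V` a `σ⁻¹`-linear map (additive, `Φ (a • v) = σ⁻¹ a • Φ v`).  If the pair `(V, Φ)` is simple, i.e. `V ≠ 0` and
the only `K`-subspaces `W ⊆ V` with `Φ(W) ⊆ W` are `0` and `V`, then `dim_K V = 1`. -/
theorem simple_sigma_inv_space_one_dimensional
    (p n : ℕ) [Fact p.Prime] (hn : n ≠ 0)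
    (K : Type*) [Field K] [Algebra (GaloisField p n) K] [IsAlgClosure (GaloisField p n) K]
    (σ : K ≃+* K) (hσ : ∀ x : K, σ x = x ^ p ^ n)
    (V : Type*) [AddCommGroup V] [Module K V] [FiniteDimensional K V]
    (Φ : V → V)
    (hadd : ∀ u v : V, Φ (u + v) = Φ u + Φ v)
    (hsmul : ∀ (a : K) (v : V), Φ (a • v) = σ.symm a • Φ v)
    (hnz : ∃ v : V, v ≠ 0)
    (hsimple : ∀ W : Submodule K V, (∀ x ∈ W, Φ x ∈ W) → W = ⊥ ∨ W = ⊤) :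
    Module.finrank K V = 1 := by
  have : IsAlgClosed K := IsAlgClosure.isAlgClosed (GaloisField p n)
  obtain ⟨v, hv⟩ := hnz
  obtain ⟨d, hd⟩ := exists_iterate_mem_iterateSpan (K := K) Φ v
  obtain ⟨w, hw, c, hc⟩ := exists_eigenvector_of_iterate_mem_iterateSpan
    (pow_pos (Fact.out : p.Prime).pos n) σ hσ hadd hsmul d hv hd
  have htop : Submodule.span K {w} = ⊤ := by
    refine (hsimple _ fun x hx => ?_).resolve_left (by simpa using hw)
    obtain ⟨a, rfl⟩ := Submodule.mem_span_singleton.1 hx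
    rw [hsmul, hc, smul_smul]
    exact Submodule.mem_span_singleton.2 ⟨_, rfl⟩
  rw [← finrank_top K V, ← htop, finrank_span_singleton hw]
end

section
/- Let x₀ ∈ G be such that every element of the double coset I x₀ I is σ-conjugate under I to x₀, and let b₀ ∈ I x₀ I. Let Y ⊆ G be a set of σ-fixed representatives of the double cosets of I in G, i.e. σ(y) = y for every y ∈ Y and G is the union of the double cosets I y I over y ∈ Y. Then for every x ∈ G the following are equivalent: (i) there exists g ∈ G with g⁻¹ b₀ σ(g) ∈ I x I (i.e. the affine Deligne–Lusztig set X_x(b₀) = {gI : g⁻¹ b₀ σ(g) ∈ IxI} is non-empty); (ii) there exists y ∈ Y with I x I ⊆ I y⁻¹ I b₀ I y I (i.e. x belongs to the superset associated to b₀). -/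
/-- **superset method.**  Let `G` be a group, `σ` an automorphism of `G`, and
`I ≤ G` a subgroup with `σ(I) = I`.  Suppose `x₀ ∈ G` is such that every element of the
double coset `I x₀ I` is `σ`-conjugate under `I` to `x₀`, and let `b₀ ∈ I x₀ I`.  Let
`Y ⊆ G` be a set of `σ`-fixed representatives of the `I`-double cosets of `G`.  Then for
every `x ∈ G`:  there exists `g ∈ G` with `g⁻¹ b₀ σ(g) ∈ I x I` (i.e. `X_x(b₀) ≠ ∅`)
if and only if there exists `y ∈ Y` with `I x I ⊆ I y⁻¹ I b₀ I y I`. -/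
theorem superset_method
    {G : Type*} [Group G] (σ : G ≃* G)
    (I : Subgroup G) (hI : ∀ g : G, σ g ∈ I ↔ g ∈ I)
    (x₀ : G)
    (hx₀ : ∀ g ∈ {g : G | ∃ i ∈ I, ∃ j ∈ I, g = i * x₀ * j},
      ∃ i ∈ I, g = i⁻¹ * x₀ * σ i)
    (b₀ : G) (hb₀ : ∃ i ∈ I, ∃ j ∈ I, b₀ = i * x₀ * j)
    (Y : Set G)
    (hYfix : ∀ y ∈ Y, σ y = y)
    (hYrep : ∀ g : G, ∃ y ∈ Y, ∃ i ∈ I, ∃ j ∈ I, g = i * y * j)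
    (x : G) :
    (∃ g : G, ∃ i ∈ I, ∃ j ∈ I, g⁻¹ * b₀ * σ g = i * x * j) ↔
    (∃ y ∈ Y, {g : G | ∃ i ∈ I, ∃ j ∈ I, g = i * x * j} ⊆
      {g : G | ∃ i₁ ∈ I, ∃ i₂ ∈ I, ∃ i₃ ∈ I, ∃ i₄ ∈ I,
        g = i₁ * y⁻¹ * i₂ * b₀ * i₃ * y * i₄}) := by
  constructor
  · rintro ⟨g, i, hi, j, hj, h⟩
    obtain ⟨y, hy, p, hp, q, hq, rfl⟩ := hYrep g
    refine ⟨y, hy, ?_⟩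
    rintro _ ⟨a, ha, c, hc, rfl⟩
    refine ⟨a * i⁻¹ * q⁻¹, I.mul_mem (I.mul_mem ha (I.inv_mem hi)) (I.inv_mem hq),
      p⁻¹, I.inv_mem hp, σ p, (hI p).2 hp, σ q * j⁻¹ * c,
      I.mul_mem (I.mul_mem ((hI q).2 hq) (I.inv_mem hj)) hc, ?_⟩
    have hx : x = i⁻¹ * ((p * y * q)⁻¹ * b₀ * σ (p * y * q)) * j⁻¹ := by
      rw [h]; group
    rw [hx, map_mul, map_mul, hYfix y hy]
    group
  · rintro ⟨y, hy, hsub⟩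
    obtain ⟨i₁, h₁, i₂, h₂, i₃, h₃, i₄, h₄, hx⟩ :=
      hsub ⟨1, I.one_mem, 1, I.one_mem, show x = 1 * x * 1 by group⟩
    obtain ⟨v, -, hv⟩ := hx₀ b₀ hb₀
    obtain ⟨i, hi, j, hj, hij⟩ := hb₀
    obtain ⟨u, -, hu⟩ := hx₀ (i₂ * b₀ * i₃)
      ⟨i₂ * i, I.mul_mem h₂ hi, j * i₃, I.mul_mem hj h₃, by rw [hij]; group⟩
    refine ⟨v⁻¹ * u * y, i₁⁻¹, I.inv_mem h₁, i₄⁻¹, I.inv_mem h₄, ?_⟩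
    calc (v⁻¹ * u * y)⁻¹ * b₀ * σ (v⁻¹ * u * y)
        = y⁻¹ * (u⁻¹ * x₀ * σ u) * y := by
          rw [hv, map_mul, map_mul, map_inv, hYfix y hy]; group
      _ = i₁⁻¹ * x * i₄⁻¹ := by rw [← hu, hx]; group
end

section
/- If x = (λ, w) ∈ W̃ maps the base alcove onto itself, x·𝐚 = 𝐚, then the translation part λ is dominant and minuscule: α(λ) ∈ {0, 1} for every positive root α ∈ R⁺. -/
/-- Let `V` be a finite-dimensional real vector space, `R ⊆ V*` a finite
crystallographic root system with coroots, `W ≤ GL(V)` the Weyl group generated by the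
reflections, and `R⁺ = Rplus` a positive system (cut out by a regular element, with
`R = R⁺ ∪ (-R⁺)`).  Let `X ⊆ V` be a `W`-stable additive subgroup containing the coroots
with `α(μ) ∈ ℤ` for all `α ∈ R`, `μ ∈ X`.  The extended affine Weyl group `W̃ = X ⋊ W`
acts on `V` by `(λ, w) · v = w(v) + λ`, and the base alcove is
`𝐚 = {v : 0 < α(v) < 1 for all α ∈ R⁺}`.  If `x = (λ, w) ∈ W̃` maps the base alcove onto
itself, `x · 𝐚 = 𝐚`, then the translation part `λ` is dominant and minuscule:
`α(λ) ∈ {0, 1}` for every positive root `α ∈ R⁺`. -/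
theorem translation_part_of_alcove_stabilizer_is_minuscule
    {V : Type*} [AddCommGroup V] [Module ℝ V] [FiniteDimensional ℝ V]
    (R : Set (V →ₗ[ℝ] ℝ)) (hRfin : R.Finite)
    (coroot : (V →ₗ[ℝ] ℝ) → V)
    (hpair : ∀ α ∈ R, α (coroot α) = 2)
    (hcrys : ∀ α ∈ R, ∀ β ∈ R, ∃ m : ℤ, β (coroot α) = (m : ℝ))
    (hrefl : ∀ α ∈ R, ∀ β ∈ R, β - β (coroot α) • α ∈ R)
    (hcorefl : ∀ α ∈ R, ∀ β ∈ R, ∃ γ ∈ R, coroot β - α (coroot β) • coroot α = coroot γ)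
    (W : Subgroup (V ≃ₗ[ℝ] V))
    (hW : W = Subgroup.closure
      {s : V ≃ₗ[ℝ] V | ∃ α ∈ R, ∀ u : V, s u = u - α u • coroot α})
    (Rplus : Set (V →ₗ[ℝ] ℝ)) (hRplusR : Rplus ⊆ R)
    (hpos : ∃ f : V, ∀ α ∈ R, (α ∈ Rplus ↔ 0 < α f))
    (hsplit : ∀ α ∈ R, α ∈ Rplus ∨ -α ∈ Rplus)
    (X : AddSubgroup V)
    (hXW : ∀ u : V ≃ₗ[ℝ] V, u ∈ W → ∀ μ ∈ X, u μ ∈ X)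
    (hQX : ∀ α ∈ R, coroot α ∈ X)
    (hXint : ∀ α ∈ R, ∀ μ ∈ X, ∃ m : ℤ, α μ = (m : ℝ))
    (lam : V) (hlam : lam ∈ X)
    (w : V ≃ₗ[ℝ] V) (hw : w ∈ W)
    (halcove : (fun v : V => w v + lam) '' {v : V | ∀ α ∈ Rplus, 0 < α v ∧ α v < 1}
      = {v : V | ∀ α ∈ Rplus, 0 < α v ∧ α v < 1}) :
    ∀ α ∈ Rplus, α lam = 0 ∨ α lam = 1 := by
  intro α hα
  obtain ⟨f, hf⟩ := hpos
  obtain ⟨M, hM⟩ := (hRfin.image fun β : V →ₗ[ℝ] ℝ => β f).bddAbove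
  set c : ℝ := α (w f) with hc
  set D : ℝ := |M| + |c| + 1 with hD
  have hDpos : 0 < D := by positivity
  have hmem : D⁻¹ • f ∈ {v : V | ∀ β ∈ Rplus, 0 < β v ∧ β v < 1} := by
    intro β hβ
    have hβf : 0 < β f := (hf β (hRplusR hβ)).1 hβ
    have hβM : β f ≤ M := hM ⟨β, hRplusR hβ, rfl⟩
    have hβD : β f < D := by
      linarith [le_abs_self M, abs_nonneg c]
    rw [map_smul, smul_eq_mul, inv_mul_eq_div]
    exact ⟨div_pos hβf hDpos, (div_lt_one hDpos).2 hβD⟩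
  have himg : w (D⁻¹ • f) + lam ∈ {v : V | ∀ β ∈ Rplus, 0 < β v ∧ β v < 1} := by
    rw [← halcove]
    exact ⟨_, hmem, rfl⟩
  obtain ⟨k, hk⟩ := hXint α (hRplusR hα) lam hlam
  have hval : α (w (D⁻¹ • f) + lam) = c / D + k := by
    rw [map_add, map_smul, map_smul, smul_eq_mul, inv_mul_eq_div, hk]
  have hbounds := himg α hα
  rw [hval] at hbounds
  have hsmall : |c / D| < 1 := by
    rw [abs_div, abs_of_pos hDpos, div_lt_one hDpos]
    linarith [abs_nonneg M]
  rw [abs_lt] at hsmall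
  have hk₀ : (-1 : ℤ) < k := by
    exact_mod_cast (by linarith : (-1 : ℝ) < k)
  have hk₂ : k < (2 : ℤ) := by
    exact_mod_cast (by linarith : (k : ℝ) < 2)
  have hk_cases : k = 0 ∨ k = 1 := by lia
  rw [hk]
  exact_mod_cast hk_cases
end
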